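/- arXiv:2309.15338 — 2 statements merged into one kernel-verified Lean document; each statement's English description precedes it below -/
import Mathlib

section
/- Fix η ∈ (0, 1/2) and a point a ∈ W. For any integers d ≥ 8 and N ≥ 1, the proportion of pairs (v₁, v₂) ∈ 𝒯_{a,V²} satisfying |dist_d(a, v₁) − dist_d(a, v₂)| ≤ 2/d^η is at least 1 − 2/d^{1−2η}. -/
/-- Euclidean distance between two points of `ℝ^d`. -/
noncomputable def dE {d : ℕ} (x y : Fin d → ℝ) : ℝ :=
  Real.sqrt (∑ i, (x i - y i) ^ 2)

/-- Normalized distance `dist(x,y)/(√d · N)`. -/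
noncomputable def dn (d N : ℕ) (x y : Fin d → ℝ) : ℝ :=
  dE x y / (Real.sqrt d * N)

/-- The lattice points `{0,1,…,N}^d` of the hypercube `[0,N]^d`. -/
noncomputable def cubeW (d N : ℕ) : Finset (Fin d → ℝ) :=
  Finset.image (fun f : Fin d → Fin (N + 1) => fun i => (f i : ℝ)) Finset.univ

/-- The `2^d` vertices `{0,N}^d` of the hypercube `[0,N]^d`. -/
noncomputable def cubeV (d N : ℕ) : Finset (Fin d → ℝ) :=
  Finset.image (fun f : Fin d → Bool => fun i => if f i then (N : ℝ) else 0) Finset.univ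

/-- The center `(N/2, …, N/2)` of the hypercube `[0,N]^d`. -/
noncomputable def ctr (d N : ℕ) : Fin d → ℝ := fun _ => (N : ℝ) / 2

/-- Average of squared Euclidean distances from `a` to the vertices. -/
noncomputable def A_V (d N : ℕ) (a : Fin d → ℝ) : ℝ :=
  (∑ v ∈ cubeV d N, dE v a ^ 2) / 2 ^ d

/-- Normalized average of squared distances from `a` to the vertices. -/
noncomputable def B_V (d N : ℕ) (a : Fin d → ℝ) : ℝ :=
  A_V d N a / (d * (N : ℝ) ^ 2)

/-- Average of squared Euclidean distances from `a` to the lattice points. -/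
noncomputable def A_W (d N : ℕ) (a : Fin d → ℝ) : ℝ :=
  (∑ w ∈ cubeW d N, dE w a ^ 2) / ((N : ℝ) + 1) ^ d

/-- Normalized average of squared distances from `a` to the lattice points. -/
noncomputable def B_W (d N : ℕ) (a : Fin d → ℝ) : ℝ :=
  A_W d N a / (d * (N : ℝ) ^ 2)

open Classical in
/-- Number of elements of a finite set satisfying a predicate. -/
noncomputable def pcount {α : Type*} (s : Finset α) (p : α → Prop) : ℕ :=
  (s.filter p).card

open Classical in
/-- Ordered pairs of vertices forming a non-degenerate triangle with `a`. -/
noncomputable def TaV (d N : ℕ) (a : Fin d → ℝ) : Finset ((Fin d → ℝ) × (Fin d → ℝ)) :=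
  ((cubeV d N) ×ˢ (cubeV d N)).filter (fun p => a ≠ p.1 ∧ a ≠ p.2 ∧ p.1 ≠ p.2)

open Classical in
/-- Ordered pairs of lattice points forming a non-degenerate triangle with `a`. -/
noncomputable def TaW (d N : ℕ) (a : Fin d → ℝ) : Finset ((Fin d → ℝ) × (Fin d → ℝ)) :=
  ((cubeW d N) ×ˢ (cubeW d N)).filter (fun p => a ≠ p.1 ∧ a ≠ p.2 ∧ p.1 ≠ p.2)

/-- Cosine of the angle at `c` in the triangle `(a, c, v)`. -/
noncomputable def cosAngleAt {d : ℕ} (c a v : Fin d → ℝ) : ℝ :=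
  (∑ i, (a i - c i) * (v i - c i)) / (dE a c * dE v c)

/-- The sign `±1` attached to a Boolean. -/
def boolSign (b : Bool) : ℝ := if b then 1 else -1

/-- The vertex of `[0,N]^d` encoded by a Boolean vector. -/
def cubeVertex (d N : ℕ) (f : Fin d → Bool) : Fin d → ℝ :=
  fun i => if f i then (N : ℝ) else 0

lemma cubeVertex_injective {d N : ℕ} (hN : 1 ≤ N) : Function.Injective (cubeVertex d N) := by
  intro f g h
  have hN' : (N : ℝ) ≠ 0 := by positivity
  ext i
  have hi := congrFun h i
  simp only [cubeVertex] at hi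
  cases hf : f i <;> cases hg : g i <;> simp [hf, hg, hN', hN'.symm] at hi ⊢

lemma cubeV_eq_image (d N : ℕ) : cubeV d N = Finset.univ.image (cubeVertex d N) := rfl

lemma card_cubeV {d N : ℕ} (hN : 1 ≤ N) : (cubeV d N).card = 2 ^ d := by
  rw [cubeV_eq_image, Finset.card_image_of_injective _ (cubeVertex_injective hN)]
  simp

lemma sum_boolSign_mul_boolSign {d : ℕ} (i j : Fin d) :
    ∑ f : Fin d → Bool, boolSign (f i) * boolSign (f j) = if i = j then (2 : ℝ) ^ d else 0 := by
  split_ifs with h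
  · subst h
    have : ∀ b : Bool, boolSign b * boolSign b = 1 := by
      intro b; cases b <;> simp [boolSign]
    simp [this]
  · refine Finset.sum_involution (fun f _ => Function.update f i (!f i)) ?_ ?_ ?_ ?_
    · intro f _
      rw [Function.update_self, Function.update_of_ne (Ne.symm h)]
      cases f i <;> cases f j <;> simp [boolSign]
    · intro f _ _ he
      have := congrFun he i
      simp at this
    · simp
    · simp

lemma sum_sq_signed_sum {d : ℕ} (c : Fin d → ℝ) :
    ∑ f : Fin d → Bool, (∑ i, boolSign (f i) * c i) ^ 2 = 2 ^ d * ∑ i, c i ^ 2 := by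
  calc ∑ f : Fin d → Bool, (∑ i, boolSign (f i) * c i) ^ 2
      = ∑ f : Fin d → Bool, ∑ i, ∑ j, c i * c j * (boolSign (f i) * boolSign (f j)) := by
        refine Finset.sum_congr rfl fun f _ => ?_
        rw [sq, Finset.sum_mul_sum]
        refine Finset.sum_congr rfl fun i _ => Finset.sum_congr rfl fun j _ => ?_
        ring
    _ = ∑ i, ∑ j, c i * c j * ∑ f : Fin d → Bool, boolSign (f i) * boolSign (f j) := by
        rw [Finset.sum_comm]
        refine Finset.sum_congr rfl fun i _ => ?_
        rw [Finset.sum_comm]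
        simp only [Finset.mul_sum]
    _ = 2 ^ d * ∑ i, c i ^ 2 := by
        simp only [sum_boolSign_mul_boolSign, mul_ite, mul_zero, Finset.sum_ite_eq,
          Finset.mem_univ, if_true, Finset.mul_sum]
        refine Finset.sum_congr rfl fun i _ => ?_
        ring

lemma dn_nonneg {d N : ℕ} (x y : Fin d → ℝ) : 0 ≤ dn d N x y := by
  unfold dn dE; positivity

lemma dn_sq {d N : ℕ} (x y : Fin d → ℝ) :
    dn d N x y ^ 2 = (∑ i, (x i - y i) ^ 2) / (d * (N : ℝ) ^ 2) := by
  rw [dn, dE, div_pow, mul_pow, Real.sq_sqrt (Finset.sum_nonneg fun i _ => sq_nonneg _),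
    Real.sq_sqrt (Nat.cast_nonneg d)]

/-- The squared normalized distance to a vertex is its mean plus a signed sum. -/
lemma dn_cubeVertex_sq {d N : ℕ} (hd : 1 ≤ d) (hN : 1 ≤ N) (a : Fin d → ℝ)
    (f : Fin d → Bool) :
    dn d N a (cubeVertex d N f) ^ 2 =
      (1 + (∑ i, (1 - 2 * a i / N) ^ 2) / d) / 4 +
        (∑ i, boolSign (f i) * (1 - 2 * a i / N)) / (2 * d) := by
  have hN' : (N : ℝ) ≠ 0 := by positivity
  have hd' : (d : ℝ) ≠ 0 := by positivity
  have key : ∑ i, (a i - cubeVertex d N f i) ^ 2 =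
      (N : ℝ) ^ 2 * (d / 4 + (∑ i, (1 - 2 * a i / N) ^ 2) / 4 +
        (∑ i, boolSign (f i) * (1 - 2 * a i / N)) / 2) := by
    have hc : (d : ℝ) / 4 = ∑ _i : Fin d, (1 / 4 : ℝ) := by
      simp [div_eq_mul_inv]
    rw [hc, Finset.sum_div, Finset.sum_div, ← Finset.sum_add_distrib, ← Finset.sum_add_distrib,
      Finset.mul_sum]
    refine Finset.sum_congr rfl fun i _ => ?_
    cases h : f i <;> simp only [cubeVertex, boolSign, h, if_true, Bool.false_eq_true, if_false] <;>
      field_simp <;> ring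
  rw [dn_sq, key]
  field_simp

lemma sq_one_sub_le_one {d N : ℕ} (hN : 1 ≤ N) {a : Fin d → ℝ} (ha : a ∈ cubeW d N)
    (i : Fin d) : (1 - 2 * a i / N) ^ 2 ≤ 1 := by
  obtain ⟨g, -, rfl⟩ := Finset.mem_image.mp ha
  have hN' : (0 : ℝ) < N := by positivity
  have h1 : ((g i : ℕ) : ℝ) ≤ N := by exact_mod_cast Nat.lt_succ_iff.mp (g i).isLt
  have h2 : ((g i : ℕ) : ℝ) / N ≤ 1 := (div_le_one hN').mpr h1
  have h3 : 0 ≤ ((g i : ℕ) : ℝ) / N := by positivity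
  rw [mul_div_assoc]
  nlinarith

open Classical in
/-- Chebyshev bound for the vertices whose distance to `a` is far from the mean. -/
lemma card_far_vertices_le {d N : ℕ} (hd : 1 ≤ d) (hN : 1 ≤ N) {a : Fin d → ℝ}
    (ha : a ∈ cubeW d N) {δ : ℝ} (hδ : 0 ≤ δ) :
    ∃ r : ℝ, (((cubeV d N).filter fun v => δ < |dn d N a v - r|).card : ℝ) * (2 * (d * δ ^ 2)) ≤
      2 ^ d := by
  have hd' : (0 : ℝ) < d := by positivity
  set S : ℝ := ∑ i, (1 - 2 * a i / N) ^ 2 with hS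
  have hS0 : 0 ≤ S := Finset.sum_nonneg fun i _ => sq_nonneg _
  have hSd : S ≤ d := by
    calc S ≤ ∑ _i : Fin d, (1 : ℝ) := Finset.sum_le_sum fun i _ => sq_one_sub_le_one hN ha i
      _ = d := by simp
  set B : ℝ := (1 + S / d) / 4 with hB
  have hB0 : 0 ≤ B := by positivity
  refine ⟨√B, ?_⟩
  set G := Finset.univ.filter fun f => δ < |dn d N a (cubeVertex d N f) - √B| with hG
  have hcard : ((cubeV d N).filter fun v => δ < |dn d N a v - √B|).card ≤ G.card := by
    rw [cubeV_eq_image, Finset.filter_image]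
    exact Finset.card_image_le
  have hpoint : ∀ f ∈ G, d * δ ^ 2 * (d + S) ≤ (∑ i, boolSign (f i) * (1 - 2 * a i / N)) ^ 2 := by
    intro f hf
    have hf' : δ < |dn d N a (cubeVertex d N f) - √B| := (Finset.mem_filter.mp hf).2
    have hx := dn_nonneg (N := N) a (cubeVertex d N f)
    have hX := dn_cubeVertex_sq hd hN a f
    rw [← hS, ← hB] at hX
    set x := dn d N a (cubeVertex d N f)
    set Y := ∑ i, boolSign (f i) * (1 - 2 * a i / N)
    have h1 : δ ^ 2 ≤ (x - √B) ^ 2 := by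
      rw [← sq_abs (x - √B)]
      exact pow_le_pow_left₀ hδ hf'.le 2
    have h2 : B ≤ (x + √B) ^ 2 := by
      nlinarith [Real.sq_sqrt hB0, Real.sqrt_nonneg B, mul_nonneg hx (Real.sqrt_nonneg B)]
    have h3 : δ ^ 2 * B ≤ (Y / (2 * d)) ^ 2 := by
      calc δ ^ 2 * B ≤ (x - √B) ^ 2 * (x + √B) ^ 2 := by gcongr
        _ = (x ^ 2 - √B ^ 2) ^ 2 := by ring
        _ = (Y / (2 * d)) ^ 2 := by rw [Real.sq_sqrt hB0, hX]; ring
    calc d * δ ^ 2 * (d + S) = (2 * d) ^ 2 * (δ ^ 2 * B) := by rw [hB]; field_simp; ring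
      _ ≤ (2 * d) ^ 2 * (Y / (2 * d)) ^ 2 := by gcongr
      _ = Y ^ 2 := by field_simp
  have hsum : (G.card : ℝ) * (d * δ ^ 2 * (d + S)) ≤ 2 ^ d * S := by
    rw [← sum_sq_signed_sum, ← nsmul_eq_mul]
    exact (Finset.card_nsmul_le_sum _ _ _ hpoint).trans
      (Finset.sum_le_univ_sum_of_nonneg fun f => sq_nonneg _)
  have hfin : (G.card : ℝ) * (2 * (d * δ ^ 2)) ≤ 2 ^ d := by
    have hp : (0 : ℝ) < d + S := by positivity
    refine le_of_mul_le_mul_right ?_ hp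
    have : (2 : ℝ) ^ d * (2 * S) ≤ 2 ^ d * (d + S) := by gcongr; linarith
    nlinarith
  refine le_trans ?_ hfin
  gcongr

open Classical in
lemma two_mul_card_TaV_ge {d N : ℕ} (hd : 8 ≤ d) (hN : 1 ≤ N) (a : Fin d → ℝ) :
    2 ^ d * 2 ^ d ≤ 2 * (TaV d N a).card := by
  have hsub : cubeV d N ×ˢ cubeV d N ⊆
      TaV d N a ∪ ((cubeV d N).image (fun v => (a, v)) ∪ ((cubeV d N).image (fun v => (v, a)) ∪
        (cubeV d N).image (fun v => (v, v)))) := by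
    rintro ⟨v, w⟩ h
    obtain ⟨hv, hw⟩ := Finset.mem_product.mp h
    simp only [TaV, Finset.mem_union, Finset.mem_filter, Finset.mem_image, Prod.mk.injEq]
    by_cases h1 : a = v
    · exact Or.inr (Or.inl ⟨w, hw, h1, rfl⟩)
    by_cases h2 : a = w
    · exact Or.inr (Or.inr (Or.inl ⟨v, hv, rfl, h2⟩))
    by_cases h3 : v = w
    · exact Or.inr (Or.inr (Or.inr ⟨v, hv, rfl, h3⟩))
    · exact Or.inl ⟨h, h1, h2, h3⟩
  have h := Finset.card_le_card hsub
  rw [Finset.card_product] at h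
  have u1 := Finset.card_union_le (TaV d N a) ((cubeV d N).image (fun v => (a, v)) ∪
    ((cubeV d N).image (fun v => (v, a)) ∪ (cubeV d N).image (fun v => (v, v))))
  have u2 := Finset.card_union_le ((cubeV d N).image (fun v => (a, v)))
    ((cubeV d N).image (fun v => (v, a)) ∪ (cubeV d N).image (fun v => (v, v)))
  have u3 := Finset.card_union_le ((cubeV d N).image (fun v => (v, a)))
    ((cubeV d N).image (fun v => (v, v)))
  have i1 := Finset.card_image_le (s := cubeV d N) (f := fun v => (a, v))
  have i2 := Finset.card_image_le (s := cubeV d N) (f := fun v => (v, a))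
  have i3 := Finset.card_image_le (s := cubeV d N) (f := fun v => (v, v))
  rw [card_cubeV hN] at *
  have hpow : 2 ^ 8 ≤ 2 ^ d := Nat.pow_le_pow_right (by norm_num) hd
  nlinarith

open Classical in
/-- Pairs of vertices at distances from `a` differing by more than `2δ` contain a vertex whose
distance to `a` is more than `δ` away from `r`. -/
lemma card_TaV_far_le {d N : ℕ} (hN : 1 ≤ N) (a : Fin d → ℝ) (δ r : ℝ) :
    ((TaV d N a).filter fun p => ¬ |dn d N a p.1 - dn d N a p.2| ≤ 2 * δ).card ≤
      2 * (((cubeV d N).filter fun v => δ < |dn d N a v - r|).card * 2 ^ d) := by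
  set G := (cubeV d N).filter fun v => δ < |dn d N a v - r|
  have hsub : ((TaV d N a).filter fun p => ¬ |dn d N a p.1 - dn d N a p.2| ≤ 2 * δ) ⊆
      G ×ˢ cubeV d N ∪ cubeV d N ×ˢ G := by
    rintro ⟨v, w⟩ h
    obtain ⟨hT, hfar⟩ := Finset.mem_filter.mp h
    obtain ⟨hv, hw⟩ := Finset.mem_product.mp (Finset.mem_filter.mp hT).1
    simp only [Finset.mem_union, Finset.mem_product, G, Finset.mem_filter]
    by_cases h1 : δ < |dn d N a v - r|
    · exact Or.inl ⟨⟨hv, h1⟩, hw⟩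
    · refine Or.inr ⟨hv, hw, ?_⟩
      have htri := abs_sub_le (dn d N a v) r (dn d N a w)
      rw [abs_sub_comm r] at htri
      simp only at hfar hw ⊢
      linarith
  refine (Finset.card_le_card hsub).trans ((Finset.card_union_le _ _).trans ?_)
  rw [Finset.card_product, Finset.card_product, card_cubeV hN]
  apply le_of_eq
  ring

theorem stmt6 (η : ℝ) (hη : η ∈ Set.Ioo (0 : ℝ) (1 / 2)) (d N : ℕ) (hd : 8 ≤ d) (hN : 1 ≤ N)
    (a : Fin d → ℝ) (ha : a ∈ cubeW d N) :
    (1 : ℝ) - 2 / (d : ℝ) ^ ((1 : ℝ) - 2 * η) ≤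
      (pcount (TaV d N a)
          (fun p => |dn d N a p.1 - dn d N a p.2| ≤ 2 / (d : ℝ) ^ η) : ℝ) /
        (TaV d N a).card := by
  obtain ⟨r, hr⟩ := card_far_vertices_le (by omega : 1 ≤ d) hN ha
    (δ := 1 / (d : ℝ) ^ η) (by positivity)
  have hd' : (0 : ℝ) < d := by positivity
  have hK : d * (1 / (d : ℝ) ^ η) ^ 2 = (d : ℝ) ^ ((1 : ℝ) - 2 * η) := by
    rw [Real.rpow_sub hd', Real.rpow_one, mul_comm 2 η, Real.rpow_mul hd'.le]
    norm_num
    rfl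
  rw [hK] at hr
  have hfar := card_TaV_far_le hN a (1 / (d : ℝ) ^ η) r
  have hT := two_mul_card_TaV_ge hd hN a
  classical
  have hsplit := Finset.card_filter_add_card_filter_not (s := TaV d N a)
    (fun p => |dn d N a p.1 - dn d N a p.2| ≤ 2 / (d : ℝ) ^ η)
  rw [mul_one_div] at hfar
  have hKpos : 0 < (d : ℝ) ^ ((1 : ℝ) - 2 * η) := by positivity
  set K := (d : ℝ) ^ ((1 : ℝ) - 2 * η)
  have hTpos : (0 : ℝ) < (TaV d N a).card := by
    have : 0 < 2 ^ d * 2 ^ d := by positivity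
    exact_mod_cast (by omega : 0 < (TaV d N a).card)
  have hgood : (pcount (TaV d N a)
      (fun p => |dn d N a p.1 - dn d N a p.2| ≤ 2 / (d : ℝ) ^ η) : ℝ) =
      (TaV d N a).card - (((TaV d N a).filter fun p =>
        ¬ |dn d N a p.1 - dn d N a p.2| ≤ 2 / (d : ℝ) ^ η).card : ℝ) := by
    rw [eq_sub_iff_add_eq, pcount]
    exact_mod_cast hsplit
  rw [hgood, sub_div, div_self hTpos.ne']
  refine sub_le_sub_left ?_ 1
  rw [div_le_div_iff₀ hTpos hKpos]
  have hfar' := (Nat.cast_le (α := ℝ)).mpr hfar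
  have hT' := (Nat.cast_le (α := ℝ)).mpr hT
  push_cast at hfar' hT'
  have h1 := mul_le_mul_of_nonneg_right hfar' hKpos.le
  have h2 := mul_le_mul_of_nonneg_right hr (by positivity : (0 : ℝ) ≤ 2 ^ d)
  linarith
end

section
/- Fix η ∈ (0, 1/2). For any integers d ≥ 2, N ≥ 1, and any point a ∈ W, the proportion of pairs (w₁, w₂) ∈ 𝒯_{a,W²} satisfying all of: dist_d(a, w₁) ∈ [√B_{a,W} − 1/d^η, √B_{a,W} + 1/d^η], dist_d(a, w₂) ∈ [√B_{a,W} − 1/d^η, √B_{a,W} + 1/d^η], and dist_d(w₁, w₂) ∈ [√(1/6 + 1/(3N)) − 1/d^η, √(1/6 + 1/(3N)) + 1/d^η], is at least 1 − (102/5)·(1/d^{1−2η}). -/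
section Concentration

variable {α : Type*} [Fintype α]

theorem sum_pi_succ {d : ℕ} (F : (Fin (d + 1) → α) → ℝ) :
    ∑ f, F f = ∑ x : α, ∑ g : Fin d → α, F (Fin.cons x g) := by
  rw [← Fintype.sum_prod_type' (f := fun (x : α) (g : Fin d → α) => F (Fin.cons x g))]
  exact (Fintype.sum_equiv (Fin.consEquiv fun _ => α) _ _ fun _ => rfl).symm

theorem card_pi_fin (d : ℕ) : (Fintype.card (Fin d → α) : ℝ) = (Fintype.card α : ℝ) ^ d := by
  simp

/-- The sum of `∑ i, Y i (f i)` over all `f` is determined by the averages of the `Y i`. -/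
theorem sum_pi_sum [Nonempty α] {d : ℕ} (Y : Fin d → α → ℝ) :
    ∑ f : Fin d → α, ∑ i, Y i (f i) =
      (Fintype.card α : ℝ) ^ d * ∑ i, (∑ x, Y i x) / Fintype.card α := by
  have hc : (Fintype.card α : ℝ) ≠ 0 := by exact_mod_cast Fintype.card_ne_zero
  induction d with
  | zero => simp
  | succ d ih =>
    rw [sum_pi_succ]
    simp only [Fin.sum_univ_succ, Fin.cons_zero, Fin.cons_succ, Finset.sum_add_distrib]
    rw [ih fun i => Y i.succ]
    simp only [Finset.sum_const, Finset.card_univ, nsmul_eq_mul, card_pi_fin, ← Finset.mul_sum]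
    field_simp
    ring

/-- Variance of a sum of independent coordinates, for mean-zero summands. -/
theorem sum_pi_sq_sum [Nonempty α] {d : ℕ} (Z : Fin d → α → ℝ) (hZ : ∀ i, ∑ x, Z i x = 0) :
    ∑ f : Fin d → α, (∑ i, Z i (f i)) ^ 2 =
      (Fintype.card α : ℝ) ^ d * ∑ i, (∑ x, Z i x ^ 2) / Fintype.card α := by
  have hc : (Fintype.card α : ℝ) ≠ 0 := by exact_mod_cast Fintype.card_ne_zero
  induction d with
  | zero => simp
  | succ d ih =>
    rw [sum_pi_succ]
    simp only [Fin.sum_univ_succ, Fin.cons_zero, Fin.cons_succ, add_sq, Finset.sum_add_distrib]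
    rw [ih (fun i => Z i.succ) fun i => hZ _]
    simp only [Finset.sum_const, Finset.card_univ, nsmul_eq_mul, card_pi_fin, ← Finset.mul_sum,
      ← Finset.sum_mul, hZ]
    field_simp
    ring

theorem sum_sq_sub_mean_le [Nonempty α] (y : α → ℝ) (h0 : ∀ x, 0 ≤ y x) (h1 : ∀ x, y x ≤ 1) :
    ∑ x, (y x - (∑ z, y z) / Fintype.card α) ^ 2 ≤ ∑ x, y x := by
  have hc : (Fintype.card α : ℝ) ≠ 0 := by exact_mod_cast Fintype.card_ne_zero
  set m := (∑ z, y z) / Fintype.card α with hm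
  have hs : ∑ z, y z = Fintype.card α * m := by rw [hm]; field_simp
  have hsq : ∑ x, y x ^ 2 ≤ ∑ x, y x :=
    Finset.sum_le_sum fun x _ => by nlinarith [h0 x, h1 x]
  have hexp : ∑ x, (y x - m) ^ 2 = ∑ x, y x ^ 2 - Fintype.card α * m ^ 2 := by
    simp only [sub_sq, Finset.sum_add_distrib, Finset.sum_sub_distrib, ← Finset.sum_mul,
      ← Finset.mul_sum, hs, Finset.sum_const, Finset.card_univ, nsmul_eq_mul]
    ring
  have : (0 : ℝ) ≤ Fintype.card α * m ^ 2 := by positivity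
  linarith

/-- Variance bound for a sum of independent `[0,1]`-valued coordinates. -/
theorem sum_pi_sq_sub_mean_le [Nonempty α] {d : ℕ} (Y : Fin d → α → ℝ)
    (h0 : ∀ i x, 0 ≤ Y i x) (h1 : ∀ i x, Y i x ≤ 1) :
    ∑ f : Fin d → α, (∑ i, Y i (f i) - ∑ i, (∑ x, Y i x) / Fintype.card α) ^ 2 ≤
      (Fintype.card α : ℝ) ^ d * ∑ i, (∑ x, Y i x) / Fintype.card α := by
  have hc : (Fintype.card α : ℝ) ≠ 0 := by exact_mod_cast Fintype.card_ne_zero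
  have h := sum_pi_sq_sum (fun i x => Y i x - (∑ z, Y i z) / Fintype.card α) fun i => by
    simp only [Finset.sum_sub_distrib, Finset.sum_const, Finset.card_univ, nsmul_eq_mul]
    field_simp
    simp
  simp only [Finset.sum_sub_distrib] at h
  rw [h]
  gcongr ?_ * ∑ i, ?_ / _ with i
  exact sum_sq_sub_mean_le (Y i) (h0 i) (h1 i)

theorem mul_le_sq_sub_of_lt_abs_sqrt_sub {ε s m : ℝ} (hε : 0 < ε) (hs : 0 ≤ s) (hm : 0 ≤ m)
    (h : ε < |Real.sqrt s - Real.sqrt m|) : ε ^ 2 * m ≤ (s - m) ^ 2 := by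
  have h1 : ε ^ 2 ≤ (Real.sqrt s - Real.sqrt m) ^ 2 := by
    rw [← sq_abs (Real.sqrt s - Real.sqrt m)]
    gcongr
  have h2 : m ≤ (Real.sqrt s + Real.sqrt m) ^ 2 := by
    nlinarith [Real.sq_sqrt hs, Real.sq_sqrt hm, Real.sqrt_nonneg s, Real.sqrt_nonneg m]
  calc ε ^ 2 * m ≤ (Real.sqrt s - Real.sqrt m) ^ 2 * (Real.sqrt s + Real.sqrt m) ^ 2 := by gcongr
    _ = (Real.sqrt s ^ 2 - Real.sqrt m ^ 2) ^ 2 := by ring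
    _ = (s - m) ^ 2 := by rw [Real.sq_sqrt hs, Real.sq_sqrt hm]

open Classical in
/-- Chebyshev's inequality for the square root of an average of independent `[0,1]`-valued
coordinates. -/
theorem card_sqrt_deviation_le [Nonempty α] {d : ℕ} (hd : 0 < d) (Y : Fin d → α → ℝ)
    (h0 : ∀ i x, 0 ≤ Y i x) (h1 : ∀ i x, Y i x ≤ 1) {ε : ℝ} (hε : 0 < ε) :
    ((Finset.univ.filter fun f : Fin d → α =>
        ε < |Real.sqrt ((∑ i, Y i (f i)) / d) -
          Real.sqrt ((∑ i, (∑ x, Y i x) / Fintype.card α) / d)|).card : ℝ) * (d * ε ^ 2) ≤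
      (Fintype.card α : ℝ) ^ d := by
  have hvar := sum_pi_sq_sub_mean_le Y h0 h1
  set m := ∑ i, (∑ x, Y i x) / (Fintype.card α : ℝ) with hm
  have hm0 : 0 ≤ m := Finset.sum_nonneg fun i _ =>
    div_nonneg (Finset.sum_nonneg fun x _ => h0 i x) (by positivity)
  have hd' : (0 : ℝ) < d := by exact_mod_cast hd
  set s := Finset.univ.filter fun f : Fin d → α =>
        ε < |Real.sqrt ((∑ i, Y i (f i)) / d) - Real.sqrt (m / d)| with hs
  have hle : (s.card : ℝ) * (d * ε ^ 2 * m) ≤ (Fintype.card α : ℝ) ^ d * m := by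
    refine le_trans ?_ hvar
    rw [← nsmul_eq_mul]
    refine (Finset.card_nsmul_le_sum s _ _ fun f hf => ?_).trans
      (Finset.sum_le_univ_sum_of_nonneg fun f => sq_nonneg _)
    have hf' := mul_le_sq_sub_of_lt_abs_sqrt_sub hε
      (div_nonneg (Finset.sum_nonneg fun i _ => h0 i (f i)) hd'.le) (div_nonneg hm0 hd'.le)
      (Finset.mem_filter.1 hf).2
    rw [← sub_div, div_pow, le_div_iff₀ (by positivity)] at hf'
    refine le_trans (le_of_eq ?_) hf'
    field_simp
  rcases hm0.eq_or_lt with hz | hpos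
  · have hsum : ∑ f : Fin d → α, (∑ i, Y i (f i) - m) ^ 2 = 0 :=
      le_antisymm (by simpa [← hz] using hvar) (Finset.sum_nonneg fun f _ => sq_nonneg _)
    have hs0 : s = ∅ := Finset.filter_eq_empty_iff.2 fun f _ => by
      have := (Finset.sum_eq_zero_iff_of_nonneg fun f _ => sq_nonneg _).1 hsum f (Finset.mem_univ f)
      rw [sub_eq_zero.1 (pow_eq_zero_iff two_ne_zero |>.1 this)]
      simpa using hε.le
    rw [hs0]
    simp
  · refine le_of_mul_le_mul_right ?_ hpos
    linarith

end Concentration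

/-- The real lattice point with the given natural coordinates. -/
def latticePoint {d N : ℕ} (f : Fin d → Fin (N + 1)) : Fin d → ℝ := fun i => (f i : ℝ)

theorem latticePoint_injective {d N : ℕ} :
    Function.Injective (latticePoint : (Fin d → Fin (N + 1)) → Fin d → ℝ) := fun f g h => by
  funext i
  have := congrFun h i
  exact Fin.ext (by simpa [latticePoint] using this)

theorem mem_cubeW {d N : ℕ} {w : Fin d → ℝ} :
    w ∈ cubeW d N ↔ ∃ f : Fin d → Fin (N + 1), latticePoint f = w := by
  unfold cubeW latticePoint
  simp

theorem sum_cubeW {d N : ℕ} (F : (Fin d → ℝ) → ℝ) :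
    ∑ w ∈ cubeW d N, F w = ∑ f : Fin d → Fin (N + 1), F (latticePoint f) :=
  Finset.sum_image fun _ _ _ _ h => latticePoint_injective h

theorem card_cubeW (d N : ℕ) : (cubeW d N).card = (N + 1) ^ d := by
  refine (Finset.card_image_of_injective _ latticePoint_injective).trans ?_
  simp

theorem dn_eq {d N : ℕ} (x y : Fin d → ℝ) :
    dn d N x y = Real.sqrt ((∑ i, ((x i - y i) / N) ^ 2) / d) := by
  unfold dn dE
  simp only [div_pow, ← Finset.sum_div]
  rw [div_div, Real.sqrt_div (Finset.sum_nonneg fun i _ => sq_nonneg _),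
    Real.sqrt_mul (by positivity), Real.sqrt_sq (by positivity), mul_comm]

theorem sq_div_le_one {N : ℕ} (m n : Fin (N + 1)) : (((m : ℝ) - n) / N) ^ 2 ≤ 1 := by
  have hm : (m : ℝ) ≤ N := by exact_mod_cast Nat.lt_succ_iff.1 m.2
  have hn : (n : ℝ) ≤ N := by exact_mod_cast Nat.lt_succ_iff.1 n.2
  have hm0 : (0 : ℝ) ≤ m := by positivity
  have hn0 : (0 : ℝ) ≤ n := by positivity
  rw [div_pow]
  refine div_le_one_of_le₀ ?_ (by positivity)
  exact sq_le_sq' (by linarith) (by linarith)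

theorem B_W_eq {d N : ℕ} (a : Fin d → ℝ) :
    B_W d N a =
      (∑ i, (∑ x : Fin (N + 1), ((a i - x) / N) ^ 2) / Fintype.card (Fin (N + 1))) / d := by
  have h := sum_pi_sum (fun i (x : Fin (N + 1)) => ((a i - x) / (N : ℝ)) ^ 2)
  have hsum : ∑ w ∈ cubeW d N, dE w a ^ 2 = ∑ f : Fin d → Fin (N + 1), ∑ i, (a i - f i) ^ 2 := by
    rw [sum_cubeW]
    refine Finset.sum_congr rfl fun f _ => ?_
    rw [dE, Real.sq_sqrt (Finset.sum_nonneg fun i _ => sq_nonneg _)]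
    exact Finset.sum_congr rfl fun i _ => by simp only [latticePoint]; ring
  have hN : ((N : ℝ) + 1) ^ d ≠ 0 := by positivity
  unfold B_W A_W
  rw [hsum, mul_comm (d : ℝ), ← div_div]
  congr 1
  rw [div_right_comm, div_eq_iff hN, mul_comm]
  simp only [Fintype.card_fin, Nat.cast_add, Nat.cast_one] at h ⊢
  rw [← h]
  simp only [div_pow, Finset.sum_div]

theorem sum_fin_cast (N : ℕ) : ∑ x : Fin (N + 1), (x : ℝ) = N * (N + 1) / 2 := by
  rw [Fin.sum_univ_eq_sum_range (fun n => (n : ℝ))]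
  induction N with
  | zero => simp
  | succ n ih => rw [Finset.sum_range_succ, ih]; push_cast; ring

theorem sum_fin_cast_sq (N : ℕ) :
    ∑ x : Fin (N + 1), (x : ℝ) ^ 2 = N * (N + 1) * (2 * N + 1) / 6 := by
  rw [Fin.sum_univ_eq_sum_range (fun n => (n : ℝ) ^ 2)]
  induction N with
  | zero => simp
  | succ n ih => rw [Finset.sum_range_succ, ih]; push_cast; ring

theorem mean_sq_sub {N : ℕ} (hN : 1 ≤ N) :
    (∑ p : Fin (N + 1) × Fin (N + 1), (((p.1 : ℝ) - p.2) / N) ^ 2) /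
      Fintype.card (Fin (N + 1) × Fin (N + 1)) = 1 / 6 + 1 / (3 * (N : ℝ)) := by
  have hN' : (N : ℝ) ≠ 0 := by positivity
  have hN1 : (N : ℝ) + 1 ≠ 0 := by positivity
  rw [Fintype.sum_prod_type]
  simp only [div_pow, ← Finset.sum_div, sub_sq, Finset.sum_add_distrib, Finset.sum_sub_distrib,
    ← Finset.mul_sum, ← Finset.sum_mul, Finset.sum_const, Finset.card_univ, nsmul_eq_mul,
    sum_fin_cast, sum_fin_cast_sq, Fintype.card_prod, Fintype.card_fin]
  push_cast
  field_simp
  ring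

open Classical in
theorem card_dn_deviation_le {d N : ℕ} (hd : 0 < d) {a : Fin d → ℝ} (ha : a ∈ cubeW d N) {ε : ℝ}
    (hε : 0 < ε) :
    (((cubeW d N).filter fun w => ε < |dn d N a w - Real.sqrt (B_W d N a)|).card : ℝ) *
      (d * ε ^ 2) ≤ ((N : ℝ) + 1) ^ d := by
  obtain ⟨g, rfl⟩ := mem_cubeW.1 ha
  have h := card_sqrt_deviation_le hd
    (fun i (x : Fin (N + 1)) => ((latticePoint g i - x) / (N : ℝ)) ^ 2)
    (fun i x => sq_nonneg _) (fun i x => sq_div_le_one (g i) x) hε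
  rw [← B_W_eq] at h
  simp only [Fintype.card_fin, Nat.cast_add, Nat.cast_one] at h
  refine le_trans ?_ h
  gcongr
  refine (Finset.card_le_card fun w hw => ?_).trans (Finset.card_image_le (f := latticePoint))
  obtain ⟨hw, hdev⟩ := Finset.mem_filter.1 hw
  obtain ⟨f, rfl⟩ := mem_cubeW.1 hw
  refine Finset.mem_image_of_mem _ (Finset.mem_filter.2 ⟨Finset.mem_univ _, ?_⟩)
  rwa [dn_eq] at hdev

open Classical in
theorem card_pair_dn_deviation_le {d N : ℕ} (hd : 0 < d) (hN : 1 ≤ N) {ε : ℝ} (hε : 0 < ε) :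
    (((cubeW d N ×ˢ cubeW d N).filter fun p =>
        ε < |dn d N p.1 p.2 - Real.sqrt (1 / 6 + 1 / (3 * (N : ℝ)))|).card : ℝ) * (d * ε ^ 2) ≤
      (((N : ℝ) + 1) ^ d) ^ 2 := by
  have h := card_sqrt_deviation_le hd
    (fun (_ : Fin d) (x : Fin (N + 1) × Fin (N + 1)) => (((x.1 : ℝ) - x.2) / (N : ℝ)) ^ 2)
    (fun i x => sq_nonneg _) (fun i x => sq_div_le_one x.1 x.2) hε
  have hd' : (d : ℝ) ≠ 0 := by positivity
  simp only [mean_sq_sub hN, Finset.sum_const, Finset.card_univ, Fintype.card_fin, nsmul_eq_mul,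
    mul_div_cancel_left₀ _ hd'] at h
  simp only [Fintype.card_prod, Fintype.card_fin, ← sq, Nat.cast_pow, Nat.cast_add,
    Nat.cast_one] at h
  rw [pow_right_comm]
  refine le_trans ?_ h
  gcongr
  refine (Finset.card_le_card fun w hw => ?_).trans (Finset.card_image_le
    (f := fun q : Fin d → Fin (N + 1) × Fin (N + 1) =>
      (latticePoint fun i => (q i).1, latticePoint fun i => (q i).2)))
  obtain ⟨w₁, w₂⟩ := w
  obtain ⟨hw, hdev⟩ := Finset.mem_filter.1 hw
  obtain ⟨hw₁, hw₂⟩ := Finset.mem_product.1 hw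
  obtain ⟨f, rfl⟩ := mem_cubeW.1 hw₁
  obtain ⟨g, rfl⟩ := mem_cubeW.1 hw₂
  refine Finset.mem_image.2 ⟨fun i => (f i, g i), Finset.mem_filter.2 ⟨Finset.mem_univ _, ?_⟩, rfl⟩
  rwa [dn_eq] at hdev

open Classical in
theorem card_cubeW_sq_le (d N : ℕ) (a : Fin d → ℝ) :
    (cubeW d N).card ^ 2 ≤ (TaW d N a).card + 3 * (cubeW d N).card := by
  set W := cubeW d N with hW
  have hsub : W ×ˢ W ⊆
      TaW d N a ∪ ((({a} : Finset _) ×ˢ W) ∪ (W ×ˢ {a}) ∪ W.image fun w => (w, w)) := by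
    rintro ⟨x, y⟩ hxy
    obtain ⟨hx, hy⟩ := Finset.mem_product.1 hxy
    simp only [TaW, ← hW, Finset.mem_union, Finset.mem_filter, Finset.mem_product,
      Finset.mem_singleton, Finset.mem_image, Prod.mk.injEq]
    by_cases h1 : a = x
    · exact Or.inr (Or.inl (Or.inl ⟨h1.symm, hy⟩))
    by_cases h2 : a = y
    · exact Or.inr (Or.inl (Or.inr ⟨hx, h2.symm⟩))
    by_cases h3 : x = y
    · exact Or.inr (Or.inr ⟨x, hx, rfl, h3⟩)
    exact Or.inl ⟨⟨hx, hy⟩, h1, h2, h3⟩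
  have h := (Finset.card_le_card hsub).trans (Finset.card_union_le _ _)
  have h' := Finset.card_union_le ((({a} : Finset (Fin d → ℝ)) ×ˢ W) ∪ (W ×ˢ {a}))
    (W.image fun w => (w, w))
  have h'' := Finset.card_union_le (({a} : Finset (Fin d → ℝ)) ×ˢ W) (W ×ˢ {a})
  have hi : (W.image fun w => (w, w)).card ≤ W.card := Finset.card_image_le
  simp only [Finset.card_product, Finset.card_singleton] at h h' h''
  nlinarith

theorem card_le_pcount_add_card {α : Type*} {s b : Finset α} {p : α → Prop}
    (h : ∀ x ∈ s, x ∉ b → p x) : (s.card : ℝ) ≤ pcount s p + b.card := by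
  classical
  have hsub : s ⊆ s.filter p ∪ b := fun x hx => by
    by_cases hb : x ∈ b
    · exact Finset.mem_union_right _ hb
    · exact Finset.mem_union_left _ (Finset.mem_filter.2 ⟨hx, h x hx hb⟩)
  have hc := (Finset.card_le_card hsub).trans (Finset.card_union_le _ _)
  have hp : pcount s p = (s.filter p).card := by
    unfold pcount
    congr
  rw [hp]
  exact_mod_cast hc

theorem stmt13 (η : ℝ) (hη : η ∈ Set.Ioo (0 : ℝ) (1 / 2)) (d N : ℕ) (hd : 2 ≤ d) (hN : 1 ≤ N)
    (a : Fin d → ℝ) (ha : a ∈ cubeW d N) :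
    (1 : ℝ) - (102 / 5) * (1 / (d : ℝ) ^ ((1 : ℝ) - 2 * η)) ≤
      (pcount (TaW d N a)
          (fun p =>
            dn d N a p.1 ∈ Set.Icc (Real.sqrt (B_W d N a) - 1 / (d : ℝ) ^ η)
              (Real.sqrt (B_W d N a) + 1 / (d : ℝ) ^ η) ∧
            dn d N a p.2 ∈ Set.Icc (Real.sqrt (B_W d N a) - 1 / (d : ℝ) ^ η)
              (Real.sqrt (B_W d N a) + 1 / (d : ℝ) ^ η) ∧
            dn d N p.1 p.2 ∈
              Set.Icc (Real.sqrt (1 / 6 + 1 / (3 * (N : ℝ))) - 1 / (d : ℝ) ^ η)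
                (Real.sqrt (1 / 6 + 1 / (3 * (N : ℝ))) + 1 / (d : ℝ) ^ η)) : ℝ) /
        (TaW d N a).card := by
  classical
  have hd0 : 0 < d := by omega
  have hdR : (0 : ℝ) < d := by exact_mod_cast hd0
  set ε : ℝ := 1 / (d : ℝ) ^ η with hε
  have hε0 : 0 < ε := by positivity
  have hpow : (d : ℝ) * ε ^ 2 = (d : ℝ) ^ ((1 : ℝ) - 2 * η) := by
    rw [Real.rpow_sub hdR, Real.rpow_one, two_mul, Real.rpow_add hdR, hε]
    field_simp
  have h₁ := card_dn_deviation_le hd0 ha hε0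
  have h₂ := card_pair_dn_deviation_le hd0 hN hε0
  have hT := card_cubeW_sq_le d N a
  have hWcard : ((cubeW d N).card : ℝ) = ((N : ℝ) + 1) ^ d := by
    rw [card_cubeW]; push_cast; rfl
  have hM : (4 : ℝ) ≤ ((N : ℝ) + 1) ^ d := by
    have h2 : (2 : ℝ) ≤ (N : ℝ) + 1 := by
      have : (1 : ℝ) ≤ N := by exact_mod_cast hN
      linarith
    calc (4 : ℝ) = 2 ^ 2 := by norm_num
      _ ≤ ((N : ℝ) + 1) ^ 2 := by gcongr
      _ ≤ ((N : ℝ) + 1) ^ d := pow_le_pow_right₀ (by linarith) hd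
  rw [hpow] at h₁ h₂
  set t : ℝ := (d : ℝ) ^ ((1 : ℝ) - 2 * η) with ht
  have ht0 : 0 < t := by positivity
  set M : ℝ := ((N : ℝ) + 1) ^ d with hMdef
  have hT' : M ^ 2 / 4 ≤ ((TaW d N a).card : ℝ) := by
    have : ((cubeW d N).card : ℝ) ^ 2 ≤ (TaW d N a).card + 3 * (cubeW d N).card := by
      exact_mod_cast hT
    rw [hWcard] at this
    nlinarith
  have hTpos : (0 : ℝ) < (TaW d N a).card := by
    refine lt_of_lt_of_le ?_ hT'
    positivity
  have hIcc : ∀ x c : ℝ, ¬ ε < |x - c| → x ∈ Set.Icc (c - ε) (c + ε) := fun x c h => by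
    have := abs_le.1 (not_lt.1 h)
    constructor <;> linarith
  set B₁ := (cubeW d N).filter fun w => ε < |dn d N a w - Real.sqrt (B_W d N a)|
  set B₂ := (cubeW d N ×ˢ cubeW d N).filter fun p =>
        ε < |dn d N p.1 p.2 - Real.sqrt (1 / 6 + 1 / (3 * (N : ℝ)))|
  rw [le_div_iff₀ hTpos]
  set bad := (B₁ ×ˢ cubeW d N) ∪ (cubeW d N ×ˢ B₁) ∪ B₂
  have hbadcard : (bad.card : ℝ) ≤ 2 * (B₁.card * M) + B₂.card := by
    have : bad.card ≤ B₁.card * (cubeW d N).card + (cubeW d N).card * B₁.card + B₂.card := by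
      refine (Finset.card_union_le _ _).trans ?_
      gcongr
      refine (Finset.card_union_le _ _).trans ?_
      simp only [Finset.card_product, le_refl]
    have : (bad.card : ℝ) ≤
        B₁.card * (cubeW d N).card + (cubeW d N).card * B₁.card + B₂.card := by
      exact_mod_cast this
    rw [hWcard] at this
    linarith
  have hb₁ : (B₁.card : ℝ) ≤ M / t := (le_div_iff₀ ht0).2 h₁
  have hb₂ : (B₂.card : ℝ) ≤ M ^ 2 / t := (le_div_iff₀ ht0).2 h₂
  have hb₁' : (B₁.card : ℝ) * M ≤ M ^ 2 / t := by
    calc (B₁.card : ℝ) * M ≤ M / t * M := by gcongr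
      _ = M ^ 2 / t := by ring
  have hbad : M ^ 2 / t ≤ 4 * ((TaW d N a).card * (1 / t)) := by
    rw [mul_one_div, ← mul_div_assoc]
    gcongr
    linarith
  have hnn : 0 ≤ ((TaW d N a).card : ℝ) * (1 / t) := by positivity
  refine le_trans ?_ (sub_le_iff_le_add.2 (card_le_pcount_add_card (b := bad) ?_))
  · linarith
  rintro ⟨x, y⟩ hxy hbad'
  obtain ⟨hxW, hyW⟩ := Finset.mem_product.1 (Finset.mem_filter.1 hxy).1
  simp only [bad, Finset.mem_union, not_or, Finset.mem_product, not_and] at hbad'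
  obtain ⟨⟨hx, hy⟩, hp⟩ := hbad'
  refine ⟨hIcc _ _ fun h => ?_, hIcc _ _ fun h => ?_, hIcc _ _ fun h => ?_⟩
  · exact hx (Finset.mem_filter.2 ⟨hxW, h⟩) hyW
  · exact hy hxW (Finset.mem_filter.2 ⟨hyW, h⟩)
  · exact hp (Finset.mem_filter.2 ⟨Finset.mem_product.2 ⟨hxW, hyW⟩, h⟩)
end
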